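/- Let h : ℕ → ℝ satisfy h(2) ≤ 1/4 and h(t+1) ≤ (1 - α_t) h(t) + α_t²/2 where α_t = 2/(t+2), for all t ≥ 2. Then h(t) ≤ 2/(t+2) for all t ≥ 2. -/

import Mathlib

theorem stmt12 (h : ℕ → ℝ) (hbase : h 2 ≤ 1 / 4)
    (hrec : ∀ t : ℕ, 2 ≤ t →
      h (t + 1) ≤ (1 - 2 / ((t : ℝ) + 2)) * h t + 2 / ((t : ℝ) + 2) ^ 2) :
    ∀ t : ℕ, 2 ≤ t → h t ≤ 2 / ((t : ℝ) + 2) := by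
  intro t ht
  induction t, ht using Nat.le_induction with
  | base => norm_num at hbase ⊢; linarith
  | succ t ht ih =>
    have hcoeff : (0 : ℝ) ≤ 1 - 2 / ((t : ℝ) + 2) := by
      rw [sub_nonneg, div_le_one (by positivity)]
      linarith [(Nat.cast_nonneg t : (0 : ℝ) ≤ t)]
    calc h (t + 1)
        ≤ (1 - 2 / ((t : ℝ) + 2)) * h t + 2 / ((t : ℝ) + 2) ^ 2 := hrec t ht
      _ ≤ (1 - 2 / ((t : ℝ) + 2)) * (2 / ((t : ℝ) + 2)) + 2 / ((t : ℝ) + 2) ^ 2 := by gcongr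
      _ = 2 * ((t : ℝ) + 1) / ((t : ℝ) + 2) ^ 2 := by field_simp; ring
      _ ≤ 2 / (((t + 1 : ℕ) : ℝ) + 2) := by
        rw [div_le_div_iff₀ (by positivity) (by positivity)]
        push_cast
        nlinarith
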